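/- arXiv:math/0311322 — 2 statements merged into one kernel-verified Lean document; each statement's English description precedes it below -/
import Mathlib

section
/- Let E be a nonzero finite-dimensional complex normed vector space and let Λ : E → E be an invertible linear map. Let λ > 0 be a real number which is an eigenvalue of Λ, and assume every eigenvalue μ of Λ with μ ≠ λ satisfies |μ| < λ. Let m be the least integer k ≥ 1 such that ker((Λ − λ·id)^k) = ker((Λ − λ·id)^{k+1}). Then there exists a nonzero linear map Λ_∞ : E → E whose range is contained in ker(Λ − λ·id), and a constant C > 0, such that ‖Λ^n/(n^{m−1}·λ^n) − Λ_∞‖ ≤ C/n for every integer n ≥ 1, where ‖·‖ is the operator norm. -/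
open Module

/-- The size of the largest Jordan block of `Λ` with eigenvalue `μ`: the least
integer `k ≥ 1` such that `ker((Λ - μ·id)^k) = ker((Λ - μ·id)^(k+1))`. -/
noncomputable def jordanSize {E : Type*} [AddCommGroup E] [Module ℂ E]
    (Λ : E →ₗ[ℂ] E) (μ : ℂ) : ℕ :=
  sInf {k : ℕ | 1 ≤ k ∧
    LinearMap.ker ((Λ - μ • 1) ^ k) = LinearMap.ker ((Λ - μ • 1) ^ (k + 1))}

open Filter Asymptotics Polynomial

theorem natCast_mul_pow_sub_descFactorial_le (d n : ℕ) :
    (n : ℝ) * ((n : ℝ) ^ d - n.descFactorial d) ≤ (d ^ 2 : ℕ) * (n : ℝ) ^ d := by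
  induction d with
  | zero => simp
  | succ d ih =>
    have hx : ((n.descFactorial (d + 1) : ℕ) : ℝ) = ((n : ℝ) - d) * n.descFactorial d := by
      rw [Nat.descFactorial_succ, Nat.cast_mul]
      rcases le_or_gt d n with h | h
      · rw [Nat.cast_sub h]
      · simp [Nat.descFactorial_of_lt h]
    have hle : (n.descFactorial d : ℝ) ≤ (n : ℝ) ^ d := by
      exact_mod_cast Nat.descFactorial_le_pow n d
    have hn : (0 : ℝ) ≤ n := n.cast_nonneg
    have hd : (0 : ℝ) ≤ d := d.cast_nonneg
    have hp : (0 : ℝ) ≤ (n : ℝ) ^ (d + 1) := by positivity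
    have h1 := mul_le_mul_of_nonneg_left ih hn
    have h2 := mul_le_mul_of_nonneg_left hle (mul_nonneg hd hn)
    rw [hx]
    push_cast at *
    have h3 := mul_nonneg hd hp
    rw [pow_succ] at *
    nlinarith

theorem isBigO_choose_div_pow_sub (d : ℕ) :
    (fun n : ℕ ↦ (n.choose d : ℝ) / (n : ℝ) ^ d - (d.factorial : ℝ)⁻¹)
      =O[atTop] fun n : ℕ ↦ (n : ℝ)⁻¹ := by
  refine IsBigO.of_bound ((d.factorial : ℝ)⁻¹ * (d ^ 2 : ℕ)) ?_
  filter_upwards [eventually_gt_atTop 0] with n hn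
  have hn' : (0 : ℝ) < n := by exact_mod_cast hn
  have hf : (0 : ℝ) < d.factorial := by exact_mod_cast d.factorial_pos
  have hle : (n.descFactorial d : ℝ) ≤ (n : ℝ) ^ d := by
    exact_mod_cast Nat.descFactorial_le_pow n d
  have key := natCast_mul_pow_sub_descFactorial_le d n
  have heq : (n.choose d : ℝ) / (n : ℝ) ^ d - (d.factorial : ℝ)⁻¹ =
      -((d.factorial : ℝ)⁻¹ * (((n : ℝ) ^ d - n.descFactorial d) / (n : ℝ) ^ d)) := by
    rw [Nat.descFactorial_eq_factorial_mul_choose]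
    push_cast
    field_simp
    ring
  rw [heq, norm_neg, norm_mul, Real.norm_of_nonneg (inv_nonneg.2 hf.le),
    Real.norm_of_nonneg (div_nonneg (sub_nonneg.2 hle) (by positivity)),
    Real.norm_of_nonneg (inv_nonneg.2 hn'.le), mul_assoc]
  gcongr
  rw [div_le_iff₀ (by positivity), mul_right_comm, ← div_eq_mul_inv, le_div_iff₀ hn']
  linarith

theorem isBigO_choose_div_pow_of_lt {j d : ℕ} (hjd : j < d) :
    (fun n : ℕ ↦ (n.choose j : ℝ) / (n : ℝ) ^ d) =O[atTop] fun n : ℕ ↦ (n : ℝ)⁻¹ := by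
  refine IsBigO.of_bound 1 ?_
  filter_upwards [eventually_gt_atTop 0] with n hn
  have hn' : (1 : ℝ) ≤ n := by exact_mod_cast hn
  have hle : (n.choose j : ℝ) ≤ (n : ℝ) ^ j := by
    exact_mod_cast Nat.choose_le_pow n j
  rw [one_mul, Real.norm_of_nonneg (by positivity), Real.norm_of_nonneg (by positivity),
    div_le_iff₀ (by positivity)]
  obtain ⟨e, rfl⟩ := Nat.exists_eq_add_of_lt hjd
  calc (n.choose j : ℝ) ≤ (n : ℝ) ^ (j + e) := hle.trans (pow_le_pow_right₀ hn' (by lia))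
    _ = (n : ℝ)⁻¹ * (n : ℝ) ^ (j + e + 1) := by rw [pow_succ]; field_simp

/-- The weight of the `j`-th power of the nilpotent part in the `n`-th power of a Jordan block with
eigenvalue `r`, normalized by `n ^ d * r ^ n`. -/
theorem isBigO_normalized_choose_mul_pow {r : ℝ} (hr : r ≠ 0) {j d : ℕ} (hjd : j ≤ d) :
    (fun n : ℕ ↦ ((n : ℝ) ^ d * r ^ n)⁻¹ * (n.choose j * r ^ (n - j)) -
      if j = d then (r ^ d * d.factorial)⁻¹ else 0) =O[atTop] fun n : ℕ ↦ (n : ℝ)⁻¹ := by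
  have main : (fun n : ℕ ↦ (n.choose j : ℝ) / (n : ℝ) ^ d -
      if j = d then (d.factorial : ℝ)⁻¹ else 0) =O[atTop] fun n : ℕ ↦ (n : ℝ)⁻¹ := by
    rcases hjd.eq_or_lt with rfl | h
    · simpa using isBigO_choose_div_pow_sub j
    · simpa [h.ne] using isBigO_choose_div_pow_of_lt h
  refine (main.const_mul_left (r ^ j)⁻¹).congr' ?_ EventuallyEq.rfl
  filter_upwards [eventually_ge_atTop j] with n hn
  obtain ⟨e, rfl⟩ := Nat.exists_eq_add_of_le hn
  rw [Nat.add_sub_cancel_left, pow_add]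
  split_ifs with h
  · subst h
    field_simp
  · field_simp
    simp

theorem pow_mul_eq_sum_of_pow_mul_eq_zero {R A : Type*} [CommRing R] [Ring A] [Algebra R A]
    (a p : A) (r : R) {m : ℕ} (h : (a - algebraMap R A r) ^ m * p = 0) (n : ℕ) :
    a ^ n * p = ∑ j ∈ Finset.range m,
      ((n.choose j : R) * r ^ (n - j)) • ((a - algebraMap R A r) ^ j * p) := by
  set N := a - algebraMap R A r with hN
  have hcomm : Commute N (algebraMap R A r) := (Algebra.commutes r N).symm
  have hterm (j : ℕ) : N ^ j * algebraMap R A r ^ (n - j) * (n.choose j : A) * p =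
      ((n.choose j : R) * r ^ (n - j)) • (N ^ j * p) := by
    rw [Algebra.smul_def, map_mul, map_natCast, map_pow]
    have h1 := (Nat.cast_commute (n.choose j) (N ^ j)).eq
    have h2 := (hcomm.pow_pow j (n - j)).eq
    rw [h2, mul_assoc _ (N ^ j), ← h1, ← mul_assoc,
      ← (Nat.cast_commute (n.choose j) (algebraMap R A r ^ (n - j))).eq, mul_assoc _ (N ^ j)]
  have hsum : a ^ n * p = ∑ j ∈ Finset.range (n + 1),
      ((n.choose j : R) * r ^ (n - j)) • (N ^ j * p) := by
    conv_lhs => rw [← sub_add_cancel a (algebraMap R A r), ← hN, hcomm.add_pow, Finset.sum_mul]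
    exact Finset.sum_congr rfl fun j _ ↦ hterm j
  have hvanish (j : ℕ) (hj : m ≤ j ∨ n < j) :
      ((n.choose j : R) * r ^ (n - j)) • (N ^ j * p) = 0 := by
    rcases hj with hj | hj
    · rw [← Nat.sub_add_cancel hj, pow_add, mul_assoc, h, mul_zero, smul_zero]
    · simp [Nat.choose_eq_zero_of_lt hj]
  rw [hsum, Finset.sum_subset (Finset.range_mono (le_max_left (n + 1) m))
      fun j _ hj ↦ hvanish j (.inr (by simpa using hj)),
    Finset.sum_subset (Finset.range_mono (le_max_right (n + 1) m))
      fun j _ hj ↦ hvanish j (.inl (by simpa using hj))]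

theorem isBigO_normalized_pow_mul_sub {A : Type*} [NormedRing A] [NormedAlgebra ℝ A]
    (a p : A) {r : ℝ} (hr : r ≠ 0) {d : ℕ} (h : (a - algebraMap ℝ A r) ^ (d + 1) * p = 0) :
    (fun n : ℕ ↦ ((n : ℝ) ^ d * r ^ n)⁻¹ • (a ^ n * p) -
      (r ^ d * d.factorial)⁻¹ • ((a - algebraMap ℝ A r) ^ d * p))
      =O[atTop] fun n : ℕ ↦ (n : ℝ)⁻¹ := by
  set N := a - algebraMap ℝ A r
  have heq (n : ℕ) : ((n : ℝ) ^ d * r ^ n)⁻¹ • (a ^ n * p) -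
      (r ^ d * d.factorial)⁻¹ • (N ^ d * p) = ∑ j ∈ Finset.range (d + 1),
        (((n : ℝ) ^ d * r ^ n)⁻¹ * (n.choose j * r ^ (n - j)) -
          if j = d then (r ^ d * d.factorial)⁻¹ else 0) • (N ^ j * p) := by
    rw [pow_mul_eq_sum_of_pow_mul_eq_zero a p r h n]
    simp [sub_smul, Finset.smul_sum, mul_smul, ite_smul, N]
  simp_rw [heq]
  refine IsBigO.fun_sum fun j hj ↦ ?_
  have := (isBigO_normalized_choose_mul_pow hr (Finset.mem_range_succ_iff.1 hj)).smul
    (isBigO_refl (fun _ : ℕ ↦ N ^ j * p) atTop)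
  refine this.trans (IsBigO.of_bound ‖N ^ j * p‖ (.of_forall fun n ↦ ?_))
  rw [norm_smul, mul_comm]

theorem isBigO_pow_of_spectrum_norm_lt {A : Type*} [NormedRing A] [NormedAlgebra ℂ A]
    [CompleteSpace A] [Nontrivial A] (a : A) {r : ℝ} (hr : 0 < r)
    (h : ∀ z ∈ spectrum ℂ a, ‖z‖ < r) :
    (fun n : ℕ ↦ a ^ n) =O[atTop] fun n : ℕ ↦ (n : ℝ)⁻¹ * r ^ n := by
  lift r to NNReal using hr.le
  obtain ⟨s, hs, hsr⟩ := ENNReal.lt_iff_exists_nnreal_btwn.1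
    (spectrum.spectralRadius_lt_of_forall_lt a h)
  have hsr' : (s : ℝ) < r := by exact_mod_cast hsr
  have hpow : (fun n : ℕ ↦ a ^ n) =O[atTop] fun n : ℕ ↦ (s : ℝ) ^ n := by
    refine IsBigO.of_bound 1 ?_
    filter_upwards [(spectrum.pow_nnnorm_pow_one_div_tendsto_nhds_spectralRadius a).eventually_lt_const
      hs, eventually_gt_atTop 0] with n hn hn0
    have hn' : (0 : ℝ) < n := by exact_mod_cast hn0
    have := ENNReal.rpow_le_rpow hn.le hn'.le
    rw [← ENNReal.rpow_mul, one_div_mul_cancel hn'.ne', ENNReal.rpow_one,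
      ENNReal.rpow_natCast] at this
    have h2 : ‖a ^ n‖₊ ≤ s ^ n := by exact_mod_cast this
    simpa using (show ‖a ^ n‖ ≤ (s : ℝ) ^ n by exact_mod_cast h2)
  refine hpow.trans ?_
  have hlo := (isLittleO_pow_const_mul_const_pow_const_pow_of_norm_lt 1
    (r₁ := (s : ℝ)) (r₂ := r) (by simpa using hsr')).isBigO
  refine ((isBigO_refl (fun n : ℕ ↦ (n : ℝ)⁻¹) atTop).mul hlo).congr' ?_ EventuallyEq.rfl
  filter_upwards [eventually_gt_atTop 0] with n hn
  have hn' : (n : ℝ) ≠ 0 := by exact_mod_cast hn.ne'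
  field_simp

theorem exists_isCoprime_pow_aeval_mul_eq_zero {K A : Type*} [Field K] [Ring A] [Algebra K A]
    {a : A} (ha : IsIntegral K a) (μ : K) (k : ℕ) :
    ∃ l ≥ k, ∃ q : K[X], IsCoprime ((X - C μ) ^ l) q ∧ aeval a ((X - C μ) ^ l * q) = 0 := by
  obtain ⟨q, hq, hdvd⟩ :=
    exists_eq_pow_rootMultiplicity_mul_and_not_dvd (minpoly K a) (minpoly.ne_zero ha) μ
  refine ⟨k + (minpoly K a).rootMultiplicity μ, le_self_add, q,
    ((irreducible_X_sub_C μ).coprime_iff_not_dvd.2 hdvd).pow_left, ?_⟩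
  rw [pow_add, mul_assoc, ← hq, map_mul, minpoly.aeval, mul_zero]

section JordanSize

variable {E : Type*} [AddCommGroup E] [Module ℂ E] [FiniteDimensional ℂ E]

theorem jordanSize_spec (f : E →ₗ[ℂ] E) (μ : ℂ) : 1 ≤ jordanSize f μ ∧
    LinearMap.ker ((f - μ • 1) ^ jordanSize f μ) =
      LinearMap.ker ((f - μ • 1) ^ (jordanSize f μ + 1)) := by
  refine Nat.sInf_mem (s := {k : ℕ | 1 ≤ k ∧
    LinearMap.ker ((f - μ • 1) ^ k) = LinearMap.ker ((f - μ • 1) ^ (k + 1))}) ?_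
  obtain ⟨k, -, hk⟩ := End.exists_ker_pow_eq_ker_pow_succ (f - μ • 1 : End ℂ E)
  refine ⟨k + 1, le_add_self, ?_⟩
  rw [← End.ker_pow_constant hk 1, add_assoc, ← End.ker_pow_constant hk 2]

theorem ker_pow_le_ker_pow_jordanSize (f : E →ₗ[ℂ] E) (μ : ℂ) (l : ℕ) :
    LinearMap.ker ((f - μ • 1) ^ l) ≤ LinearMap.ker ((f - μ • 1) ^ jordanSize f μ) := by
  rw [End.ker_pow_constant (jordanSize_spec f μ).2 l, pow_add]
  exact LinearMap.ker_le_ker_comp _ _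

theorem exists_mem_ker_pow_jordanSize {f : E →ₗ[ℂ] E} {μ : ℂ} (hμ : End.HasEigenvalue f μ) :
    ∃ v, ((f - μ • 1) ^ jordanSize f μ) v = 0 ∧ ((f - μ • 1) ^ (jordanSize f μ - 1)) v ≠ 0 := by
  obtain ⟨d, hd⟩ := Nat.exists_eq_add_of_le' (jordanSize_spec f μ).1
  rw [hd, Nat.add_sub_cancel]
  rcases d.eq_zero_or_pos with rfl | hpos
  · obtain ⟨v, hv⟩ := hμ.exists_hasEigenvector
    exact ⟨v, by simp [hv.apply_eq_smul], by simpa using hv.2⟩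
  · by_contra! hcon
    have hle : LinearMap.ker ((f - μ • 1) ^ d) ≤ LinearMap.ker ((f - μ • 1) ^ (d + 1)) := by
      rw [add_comm, pow_add]
      exact LinearMap.ker_le_ker_comp _ _
    have : jordanSize f μ ≤ d := Nat.sInf_le ⟨hpos, hle.antisymm fun v hv ↦ hcon v hv⟩
    lia

end JordanSize

/-- If `1 = c * x ^ l + b * q` in the algebra generated by `f`, with `x = f - μ` and
`x ^ l * q = 0`, then every nonzero eigenvalue of `f * (c * x ^ l)` is an eigenvalue of `f` other
than `μ`. -/
theorem hasEigenvalue_and_ne_of_mem_spectrum_mul_aeval {E : Type*} [AddCommGroup E] [Module ℂ E]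
    [FiniteDimensional ℂ E] {f : E →ₗ[ℂ] E} {μ : ℂ} {l : ℕ} (hl : 1 ≤ l) {b c q : ℂ[X]}
    (hq : aeval f ((X - C μ) ^ l * q) = 0) (hbc : c * (X - C μ) ^ l + b * q = 1) {z : ℂ}
    (hz : z ∈ spectrum ℂ (f * aeval f (c * (X - C μ) ^ l))) (hz0 : z ≠ 0) :
    End.HasEigenvalue f z ∧ z ≠ μ := by
  obtain ⟨v, hv⟩ := (End.hasEigenvalue_iff_mem_spectrum.2 hz).exists_hasEigenvector
  set s := c * (X - C μ) ^ l with hs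
  have happ : aeval f (X * s) v = z • v := by simpa using hv.apply_eq_smul
  have hbq : aeval f (b * q) v = 0 := by
    have h0 : aeval f (b * q * (X * s)) = 0 := by
      rw [hs, show b * q * (X * (c * (X - C μ) ^ l)) = (b * X * c) * ((X - C μ) ^ l * q) by ring,
        map_mul, hq, mul_zero]
    rw [map_mul] at h0
    have := LinearMap.congr_fun h0 v
    rw [End.mul_apply, happ, map_smul] at this
    exact (smul_eq_zero.1 this).resolve_left hz0
  have hsv : aeval f s v = v := by
    have := LinearMap.congr_fun (congrArg (aeval f) hbc) v
    simpa [-map_mul, hbq] using this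
  have hfv : f v = z • v := by
    rw [← happ, map_mul, End.mul_apply, hsv, aeval_X]
  refine ⟨End.hasEigenvalue_of_hasEigenvector ⟨End.mem_eigenspace_iff.2 hfv, hv.2⟩, ?_⟩
  rintro rfl
  apply hv.2
  rw [← hsv, hs, ← Nat.sub_add_cancel hl, pow_succ, ← mul_assoc, map_mul, End.mul_apply]
  simp [hfv]

theorem stmt1 {E : Type*} [NormedAddCommGroup E] [NormedSpace ℂ E]
    [FiniteDimensional ℂ E] [Nontrivial E]
    (Λ : E →L[ℂ] E) (hΛ : Function.Bijective Λ)
    (lam : ℝ) (hlam_pos : 0 < lam)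
    (hlam_eig : Module.End.HasEigenvalue (Λ : E →ₗ[ℂ] E) (lam : ℂ))
    (hdom : ∀ μ : ℂ, Module.End.HasEigenvalue (Λ : E →ₗ[ℂ] E) μ → μ ≠ (lam : ℂ) →
      ‖μ‖ < lam)
    (m : ℕ) (hm : m = jordanSize (Λ : E →ₗ[ℂ] E) (lam : ℂ)) :
    ∃ Λinf : E →L[ℂ] E, Λinf ≠ 0 ∧
      LinearMap.range (Λinf : E →ₗ[ℂ] E) ≤
        LinearMap.ker ((Λ : E →ₗ[ℂ] E) - (lam : ℂ) • 1) ∧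
      ∃ C : ℝ, 0 < C ∧ ∀ n : ℕ, 1 ≤ n →
        ‖(((n : ℝ) ^ (m - 1) * lam ^ n)⁻¹) • Λ ^ n - Λinf‖ ≤ C / n := by
  have : CompleteSpace E := FiniteDimensional.complete ℂ E
  set f : E →ₗ[ℂ] E := (Λ : E →ₗ[ℂ] E)
  let φ : (E →L[ℂ] E) →ₐ[ℂ] (E →ₗ[ℂ] E) :=
    { ContinuousLinearMap.toLinearMapRingHom with commutes' := fun _ ↦ rfl }
  have hφ : Function.Injective φ := ContinuousLinearMap.coe_injective
  have hφΛ : φ Λ = f := rfl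
  obtain ⟨l, hlm, q, ⟨c, b, hbc⟩, hq⟩ :=
    exists_isCoprime_pow_aeval_mul_eq_zero (Algebra.IsIntegral.isIntegral (R := ℂ) f) (lam : ℂ) m
  obtain ⟨v, hv0, hv1⟩ := exists_mem_ker_pow_jordanSize hlam_eig
  have hm1 := (jordanSize_spec f lam).1
  have hker := ker_pow_le_ker_pow_jordanSize f lam l
  rw [← hm] at hv0 hv1 hm1 hker
  obtain ⟨d, rfl⟩ := Nat.exists_eq_add_of_le' hm1
  rw [Nat.add_sub_cancel] at hv1 ⊢
  set N : E →L[ℂ] E := Λ - algebraMap ℝ (E →L[ℂ] E) lam with hN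
  have hφN : φ N = f - (lam : ℂ) • 1 := by
    ext x
    change f x - lam • x = f x - (lam : ℂ) • x
    rw [Complex.coe_smul]
  have hfN : aeval f (X - C (lam : ℂ)) = f - (lam : ℂ) • 1 := by
    simp [Algebra.algebraMap_eq_smul_one]
  set P : E →L[ℂ] E := aeval Λ (b * q)
  set Q : E →L[ℂ] E := aeval Λ (c * (X - C (lam : ℂ)) ^ l)
  have hφP : φ P = aeval f (b * q) := by rw [← hφΛ, aeval_algHom_apply]
  have hφQ : φ Q = aeval f (c * (X - C (lam : ℂ)) ^ l) := by rw [← hφΛ, aeval_algHom_apply]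
  have hQP : Q + P = 1 := by rw [← map_add, hbc, map_one]
  have hNP : N ^ (d + 1) * P = 0 := by
    apply hφ
    rw [map_mul, map_pow, hφN, hφP, map_zero]
    ext x
    refine hker (LinearMap.mem_ker.2 ?_)
    rw [← hfN, ← map_pow, ← End.mul_apply, ← map_mul,
      show (X - C (lam : ℂ)) ^ l * (b * q) = b * ((X - C (lam : ℂ)) ^ l * q) by ring,
      map_mul, hq, mul_zero, LinearMap.zero_apply]
  have hPv : P v = v := by
    have hQv : Q v = 0 := by
      change φ Q v = 0
      rw [hφQ, ← Nat.sub_add_cancel hlm, pow_add, ← mul_assoc, map_mul, End.mul_apply,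
        map_pow _ _ (d + 1), hfN, hv0, map_zero]
    simpa [hQv] using DFunLike.congr_fun hQP v
  have hQbound : (fun n : ℕ ↦ (Λ * Q) ^ n) =O[atTop] fun n : ℕ ↦ (n : ℝ)⁻¹ * lam ^ n := by
    refine isBigO_pow_of_spectrum_norm_lt _ hlam_pos fun z hz ↦ ?_
    rcases eq_or_ne z 0 with rfl | hz0
    · simpa using hlam_pos
    · rw [ContinuousLinearMap.spectrum_eq] at hz
      have hz' : z ∈ spectrum ℂ (φ (Λ * Q)) := hz
      rw [map_mul, hφΛ, hφQ] at hz'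
      obtain ⟨h1, h2⟩ :=
        hasEigenvalue_and_ne_of_mem_spectrum_mul_aeval (hm1.trans hlm) hq hbc hz' hz0
      exact hdom z h1 h2
  have hcomm : Commute Λ Q := by
    have := (Commute.all (X : ℂ[X]) (c * (X - C (lam : ℂ)) ^ l)).map (aeval (R := ℂ) Λ)
    rwa [aeval_X] at this
  have hQidem : IsIdempotentElem Q := by
    have hQP0 : Q * P = 0 := by
      apply hφ
      rw [map_mul, hφP, hφQ, ← map_mul,
        show c * (X - C (lam : ℂ)) ^ l * (b * q) = c * b * ((X - C (lam : ℂ)) ^ l * q) by ring,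
        map_mul, hq, mul_zero, map_zero]
    have := congrArg (Q * ·) hQP
    simpa [mul_add, hQP0, IsIdempotentElem] using this
  have hQerr : (fun n : ℕ ↦ ((n : ℝ) ^ d * lam ^ n)⁻¹ • (Λ ^ n * Q)) =O[atTop]
      fun n : ℕ ↦ (n : ℝ)⁻¹ := by
    have hc : (fun n : ℕ ↦ ((n : ℝ) ^ d * lam ^ n)⁻¹) =O[atTop] fun n : ℕ ↦ (lam ^ n)⁻¹ := by
      refine IsBigO.of_bound 1 ?_
      filter_upwards [eventually_gt_atTop 0] with n hn
      have hn' : (1 : ℝ) ≤ n := by exact_mod_cast hn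
      rw [one_mul, Real.norm_of_nonneg (by positivity), Real.norm_of_nonneg (by positivity)]
      gcongr
      exact le_mul_of_one_le_left (by positivity) (one_le_pow₀ hn')
    refine (hc.smul hQbound).congr' ?_ ?_
    · filter_upwards [eventually_gt_atTop 0] with n hn
      rw [hcomm.mul_pow, hQidem.pow_eq hn.ne']
    · refine .of_forall fun n ↦ ?_
      have : lam ^ n ≠ 0 := by positivity
      simp only [smul_eq_mul]
      field_simp
  have herr := (isBigO_normalized_pow_mul_sub Λ P hlam_pos.ne' hNP).add hQerr
  refine ⟨(lam ^ d * d.factorial)⁻¹ • (N ^ d * P), ?_, ?_, ?_⟩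
  · refine smul_ne_zero (by positivity) fun h0 ↦ hv1 ?_
    have := DFunLike.congr_fun h0 v
    rw [mul_apply_eq_comp, hPv] at this
    rw [← hφN, ← map_pow]
    exact this
  · rintro _ ⟨x, rfl⟩
    rw [LinearMap.mem_ker, ← hφN]
    change N ((lam ^ d * d.factorial : ℝ)⁻¹ • (N ^ d * P) x) = 0
    rw [ContinuousLinearMap.map_smul_of_tower, ← mul_apply_eq_comp, ← mul_assoc, ← pow_succ', hNP]
    simp
  · obtain ⟨K, hK, hbound⟩ := bound_of_isBigO_nat_atTop herr
    refine ⟨K, hK, fun n hn ↦ ?_⟩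
    have hn' : (0 : ℝ) < n := by exact_mod_cast hn
    have := hbound (inv_ne_zero hn'.ne')
    rw [Real.norm_of_nonneg (by positivity), ← div_eq_mul_inv, sub_add_eq_add_sub, ← smul_add,
      ← mul_add, add_comm P, hQP, mul_one] at this
    exact this
end

section
/- Let E be a nonzero finite-dimensional real normed vector space and let Λ : E → E be an invertible linear map. Let K ⊆ E be a convex cone (K + K ⊆ K and t·K ⊆ K for every real t > 0) such that Λ(K) ⊆ K, K spans E as a vector space, and closure(K) ∩ (−closure(K)) = {0}. Let λ := limsup_{n→∞} ‖Λ^n‖^{1/n}. Then there exists v ∈ closure(K) with v ≠ 0 and Λ(v) = λ·v. -/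
open Filter Topology

/-- The limit in Gelfand's formula exists, is positive at a unit, and is bounded above by every root
`‖a ^ m‖ ^ (1 / m)`. -/
theorem Units.tendsto_norm_pow_rpow_inv {R : Type*} [NormedRing R] [NormOneClass R] (a : Rˣ) :
    ∃ r : ℝ, 0 < r ∧ (∀ m : ℕ, r ^ m ≤ ‖(a : R) ^ m‖) ∧
      Tendsto (fun n : ℕ => ‖(a : R) ^ n‖ ^ ((n : ℝ)⁻¹)) atTop (𝓝 r) := by
  have : Nontrivial R := NormOneClass.nontrivial
  have hpos (n : ℕ) : 0 < ‖(a : R) ^ n‖ := by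
    rw [← Units.val_pow_eq_pow_val]
    exact Units.norm_pos _
  have hsub : Subadditive fun n : ℕ => Real.log ‖(a : R) ^ n‖ := fun m n => by
    beta_reduce
    rw [← Real.log_mul (hpos m).ne' (hpos n).ne', pow_add]
    exact Real.log_le_log (by rw [← pow_add]; exact hpos _) (norm_mul_le _ _)
  have hbdd : BddBelow (Set.range fun n : ℕ => Real.log ‖(a : R) ^ n‖ / n) := by
    refine ⟨min 0 (-Real.log ‖((a⁻¹ : Rˣ) : R)‖), ?_⟩
    rintro _ ⟨n, rfl⟩
    rcases n.eq_zero_or_pos with rfl | hn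
    · simp
    refine (min_le_right _ _).trans ?_
    rw [le_div_iff₀ (by exact_mod_cast hn)]
    have hinv : 0 < ‖((a⁻¹ : Rˣ) : R)‖ := Units.norm_pos _
    have h1 : 1 ≤ ‖(a : R) ^ n‖ * ‖((a⁻¹ : Rˣ) : R)‖ ^ n := by
      calc (1 : ℝ) = ‖(a : R) ^ n * ((a⁻¹ : Rˣ) : R) ^ n‖ := by
            rw [← Units.val_pow_eq_pow_val, ← Units.val_pow_eq_pow_val, ← Units.val_mul]
            simp
        _ ≤ ‖(a : R) ^ n‖ * ‖((a⁻¹ : Rˣ) : R) ^ n‖ := norm_mul_le _ _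
        _ ≤ _ := by gcongr; exact norm_pow_le _ _
    have h2 := Real.log_nonneg h1
    rw [Real.log_mul (hpos n).ne' (by positivity), Real.log_pow] at h2
    linarith
  refine ⟨Real.exp hsub.lim, Real.exp_pos _, fun m => ?_, ?_⟩
  · rcases m.eq_zero_or_pos with rfl | hm
    · simp
    have h := hsub.lim_le_div hbdd hm.ne'
    rw [le_div_iff₀ (by exact_mod_cast hm)] at h
    rw [← Real.exp_nat_mul, ← Real.le_log_iff_exp_le (hpos m), mul_comm]
    exact h
  · refine ((Real.continuous_exp.tendsto _).comp (hsub.tendsto_lim hbdd)).congr fun n => ?_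
    simp [Real.rpow_def_of_pos (hpos n), div_eq_mul_inv]

/-- A salient closed convex cone in finite dimension admits a uniformly positive functional. -/
theorem exists_forall_mul_norm_le_of_salient {E : Type*} [NormedAddCommGroup E] [NormedSpace ℝ E]
    [FiniteDimensional ℝ E] {C : Set E} (hC : IsClosed C) (hzero : 0 ∈ C)
    (hadd : ∀ x ∈ C, ∀ y ∈ C, x + y ∈ C) (hsmul : ∀ t : ℝ, 0 ≤ t → ∀ x ∈ C, t • x ∈ C)
    (hsal : ∀ x ∈ C, -x ∈ C → x = 0) :
    ∃ (f : E →L[ℝ] ℝ) (c : ℝ), 0 < c ∧ ∀ x ∈ C, c * ‖x‖ ≤ f x := by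
  have hconv : Convex ℝ C := fun x hx y hy a b ha hb _ =>
    hadd _ (hsmul a ha x hx) _ (hsmul b hb y hy)
  have hsep : ∀ x ∈ C, x ≠ 0 → ∃ f : E →L[ℝ] ℝ, (∀ y ∈ C, 0 ≤ f y) ∧ 0 < f x := by
    intro x hx hx0
    obtain ⟨f, u, hu, hf⟩ := geometric_hahn_banach_point_closed hconv hC
      fun h => hx0 (hsal x hx h)
    have hu0 : u < 0 := by simpa using hf 0 hzero
    refine ⟨f, fun y hy => ?_, ?_⟩
    · by_contra! hneg
      have h := hf _ (hsmul (u / f y) (div_nonneg_of_nonpos hu0.le hneg.le) y hy)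
      rw [map_smul, smul_eq_mul, div_mul_cancel₀ _ hneg.ne] at h
      exact h.false
    · rw [map_neg] at hu
      linarith
  have hB : IsCompact (C ∩ Metric.sphere 0 1) := (isCompact_sphere 0 1).inter_left hC
  obtain ⟨f, -, hf⟩ : ∃ f : E →L[ℝ] ℝ, (∀ y ∈ C, 0 ≤ f y) ∧
      ∀ x ∈ C ∩ Metric.sphere 0 1, x ∈ C → 0 < f x := by
    refine hB.induction_on (p := fun s => ∃ f : E →L[ℝ] ℝ, (∀ y ∈ C, 0 ≤ f y) ∧
      ∀ x ∈ s, x ∈ C → 0 < f x) ⟨0, by simp⟩ ?_ ?_ ?_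
    · rintro s t hst ⟨f, hf, hft⟩
      exact ⟨f, hf, fun x hx => hft x (hst hx)⟩
    · rintro s t ⟨f, hf, hfs⟩ ⟨g, hg, hgt⟩
      refine ⟨f + g, fun y hy => add_nonneg (hf y hy) (hg y hy), ?_⟩
      rintro x (hx | hx) hxC
      · exact add_pos_of_pos_of_nonneg (hfs x hx hxC) (hg x hxC)
      · exact add_pos_of_nonneg_of_pos (hf x hxC) (hgt x hx hxC)
    · intro x hx
      obtain ⟨f, hf, hfx⟩ := hsep x hx.1 (ne_zero_of_mem_unit_sphere ⟨x, hx.2⟩)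
      exact ⟨{y | 0 < f y},
        mem_nhdsWithin_of_mem_nhds (f.continuous.continuousAt.eventually_const_lt hfx),
        f, hf, fun y hy _ => hy⟩
  obtain ⟨c, hc0, hc⟩ := hB.exists_forall_le' f.continuous.continuousOn fun x hx => hf x hx hx.1
  refine ⟨f, c, hc0, fun x hx => ?_⟩
  rcases eq_or_ne x 0 with rfl | hx0
  · simp
  have hn : 0 < ‖x‖ := norm_pos_iff.2 hx0
  have h := hc (‖x‖⁻¹ • x) ⟨hsmul _ (by positivity) x hx, by simp [norm_smul, hn.ne']⟩
  rwa [map_smul, smul_eq_mul, inv_mul_eq_div, le_div_iff₀ hn] at h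

/-- In finite dimension, pointwise convergence to zero on a spanning set implies convergence to zero
in operator norm. -/
theorem ContinuousLinearMap.tendsto_zero_of_span_eq_top {ι E F : Type*} [NormedAddCommGroup E]
    [NormedSpace ℝ E] [FiniteDimensional ℝ E] [NormedAddCommGroup F] [NormedSpace ℝ F]
    {l : Filter ι} {A : ι → E →L[ℝ] F} {K : Set E} (hK : Submodule.span ℝ K = ⊤)
    (hA : ∀ x ∈ K, Tendsto (fun i => A i x) l (𝓝 0)) : Tendsto A l (𝓝 0) := by
  have hall (x : E) : Tendsto (fun i => A i x) l (𝓝 0) := by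
    have hx : x ∈ Submodule.span ℝ K := hK ▸ Submodule.mem_top
    induction hx using Submodule.span_induction with
    | mem x hx => exact hA x hx
    | zero => simpa using tendsto_const_nhds
    | add x y _ _ hx hy => simpa using hx.add hy
    | smul a x _ hx => simpa using hx.const_smul a
  let b := Module.finBasis ℝ E
  obtain ⟨C, hC, hle⟩ := b.exists_opNorm_le (F := F)
  have hsum : Tendsto (fun i => C * ∑ j, ‖A i (b j)‖) l (𝓝 0) := by
    simpa using (tendsto_finsetSum Finset.univ fun j _ => (hall (b j)).norm).const_mul C
  refine squeeze_zero_norm (fun i => hle (by positivity) fun j => ?_) hsum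
  exact Finset.single_le_sum (f := fun j => ‖A i (b j)‖) (fun _ _ => norm_nonneg _)
    (Finset.mem_univ j)

/-- A linear map preserving a salient spanning closed convex cone has an eigenvector in the cone for
its spectral radius. -/
theorem ContinuousLinearMap.exists_eigenvector_of_salient_cone {E : Type*} [NormedAddCommGroup E]
    [NormedSpace ℝ E] [FiniteDimensional ℝ E] {C : Set E} (hC : IsClosed C) (hzero : 0 ∈ C)
    (hadd : ∀ x ∈ C, ∀ y ∈ C, x + y ∈ C) (hsmul : ∀ t : ℝ, 0 ≤ t → ∀ x ∈ C, t • x ∈ C)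
    (hsal : ∀ x ∈ C, -x ∈ C → x = 0) (hspan : Submodule.span ℝ C = ⊤)
    {A : E →L[ℝ] E} (hA : ∀ x ∈ C, A x ∈ C) {r : ℝ} (hr : 0 < r)
    (hle : ∀ m : ℕ, r ^ m ≤ ‖A ^ m‖) (hlt : ∀ t, r < t → ∀ᶠ n : ℕ in atTop, ‖A ^ n‖ ≤ t ^ n) :
    ∃ v ∈ C, v ≠ 0 ∧ A v = r • v := by
  obtain ⟨f, c, hc, hf⟩ := exists_forall_mul_norm_le_of_salient hC hzero hadd hsmul hsal
  have hfC : ∀ x ∈ C, 0 ≤ f x := fun x hx => (by positivity : 0 ≤ c * ‖x‖).trans (hf x hx)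
  have hpow (n : ℕ) : ∀ x ∈ C, (A ^ n) x ∈ C := by
    induction n with
    | zero => simp
    | succ n ih => exact fun x hx => by simpa [pow_succ] using ih _ (hA x hx)
  have hterm {t : ℝ} (ht : 0 < t) (n : ℕ) : ∀ x ∈ C, (t⁻¹ ^ n) • (A ^ n) x ∈ C :=
    fun x hx => hsmul _ (by positivity) _ (hpow n x hx)
  obtain ⟨e, he, hdiv⟩ : ∃ e ∈ C, ¬ Summable fun n : ℕ => f ((r⁻¹ ^ n) • (A ^ n) e) := by
    by_contra! hsum
    have h0 : Tendsto (fun n : ℕ => (r⁻¹ ^ n) • A ^ n) atTop (𝓝 0) := by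
      refine tendsto_zero_of_span_eq_top hspan fun x hx => ?_
      refine squeeze_zero_norm (a := fun n => c⁻¹ * f ((r⁻¹ ^ n) • (A ^ n) x)) (fun n => ?_) ?_
      · rw [inv_mul_eq_div, le_div_iff₀' hc]
        exact hf _ (hterm hr n x hx)
      · simpa using (hsum x hx).tendsto_atTop_zero.const_mul c⁻¹
    obtain ⟨n, hn⟩ := (h0.norm.eventually_lt_const (by simp : ‖(0 : E →L[ℝ] E)‖ < 1)).exists
    rw [norm_smul, inv_pow, norm_inv, Real.norm_of_nonneg (by positivity), inv_mul_eq_div,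
      div_lt_one (by positivity)] at hn
    exact hn.not_ge (hle n)
  -- `u t` is the Neumann series of `t • (t - A)⁻¹` applied to `e`.
  let u : ℝ → E := fun t => ∑' n : ℕ, (t⁻¹ ^ n) • (A ^ n) e
  have hsummable {t : ℝ} (ht : r < t) : Summable fun n : ℕ => (t⁻¹ ^ n) • (A ^ n) e := by
    obtain ⟨s, hrs, hst⟩ := exists_between ht
    have hs0 : 0 < s := hr.trans hrs
    have ht0 : 0 < t := hr.trans ht
    refine Summable.of_norm_bounded_eventually_nat (g := fun n => (s / t) ^ n * ‖e‖)
      ((summable_geometric_of_lt_one (by positivity) ((div_lt_one ht0).2 hst)).mul_right _) ?_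
    filter_upwards [hlt s hrs] with n hn
    rw [norm_smul, norm_pow, norm_inv, Real.norm_of_nonneg ht0.le, div_pow, div_eq_inv_mul,
      inv_pow, mul_assoc]
    gcongr
    exact (A ^ n).le_of_opNorm_le hn e
  have hpartial {t : ℝ} (ht : r < t) (N : ℕ) :
      ∑ n ∈ Finset.range N, f ((t⁻¹ ^ n) • (A ^ n) e) ≤ f (u t) := by
    rw [f.map_tsum (hsummable ht)]
    exact (f.summable (hsummable ht)).sum_le_tsum _
      fun n _ => hfC _ (hterm (hr.trans ht) n e he)
  have huC {t : ℝ} (ht : r < t) : u t ∈ C := by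
    refine hC.mem_of_tendsto (hsummable ht).hasSum (Eventually.of_forall fun s => ?_)
    exact Finset.sum_induction _ (· ∈ C) (fun x y hx hy => hadd x hx y hy) hzero
      fun n _ => hterm (hr.trans ht) n e he
  have hAu {t : ℝ} (ht : r < t) : A (u t) = t • (u t - e) := by
    have ht0 : t ≠ 0 := (hr.trans ht).ne'
    have h := (hsummable ht).tsum_eq_zero_add
    simp only [pow_zero, one_smul] at h
    change u t = e + _ at h
    rw [sub_eq_of_eq_add' h, show u t = _ from rfl, A.map_tsum (hsummable ht),
      ← tsum_const_smul'']
    refine tsum_congr fun n => ?_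
    rw [map_smul, smul_smul, pow_succ' A, pow_succ', ← mul_assoc, mul_inv_cancel₀ ht0, one_mul,
      mul_apply_eq_comp]
  have hlarge : Tendsto (fun t => f (u t)) (𝓝[>] r) atTop := by
    refine tendsto_atTop.2 fun M => ?_
    have hN := (not_summable_iff_tendsto_nat_atTop_of_nonneg
      fun n => hfC _ (hterm hr n e he)).1 hdiv
    obtain ⟨N, hN⟩ := (hN.eventually_gt_atTop M).exists
    have hcont : ContinuousAt
        (fun t : ℝ => ∑ n ∈ Finset.range N, f ((t⁻¹ ^ n) • (A ^ n) e)) r := by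
      simp only [map_smul]
      fun_prop (disch := exact hr.ne')
    filter_upwards [nhdsWithin_le_nhds (hcont.eventually_const_lt hN), self_mem_nhdsWithin]
      with t htM htr
    exact htM.le.trans (hpartial htr N)
  have hS : IsCompact (C ∩ {x | f x = 1}) := by
    refine Metric.isCompact_of_isClosed_isBounded
      (hC.inter (isClosed_eq f.continuous continuous_const)) ?_
    refine Metric.isBounded_closedBall (x := (0 : E)) (r := c⁻¹) |>.subset ?_
    rintro x ⟨hx, hx1⟩
    rw [mem_closedBall_zero_iff, inv_eq_one_div, le_div_iff₀' hc]
    exact (hf x hx).trans_eq hx1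
  let w : ℝ → E := fun t => (f (u t))⁻¹ • u t
  have hw : ∀ᶠ t in 𝓝[>] r, w t ∈ C ∩ {x | f x = 1} := by
    filter_upwards [hlarge.eventually_gt_atTop 0, self_mem_nhdsWithin] with t ht htr
    exact ⟨hsmul _ (by positivity) _ (huC htr), by simp [w, ht.ne']⟩
  obtain ⟨v, ⟨hvC, hv1⟩, hv⟩ := hS.exists_mapClusterPt_of_frequently hw.frequently
  refine ⟨v, hvC, fun h0 => by simp [h0] at hv1, ?_⟩
  have hlim : Tendsto (fun t => A (w t) - r • w t) (𝓝[>] r) (𝓝 0) := by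
    have hbdd : ∀ᶠ t in 𝓝[>] r, ‖w t‖ ≤ c⁻¹ := by
      filter_upwards [hw] with t ⟨ht, ht1⟩
      rw [inv_eq_one_div, le_div_iff₀' hc]
      exact (hf _ ht).trans_eq ht1
    have hid : Tendsto (fun t : ℝ => t) (𝓝[>] r) (𝓝 r) := nhdsWithin_le_nhds
    have h1 : Tendsto (fun t => (t - r) • w t) (𝓝[>] r) (𝓝 0) :=
      NormedField.tendsto_zero_smul_of_tendsto_zero_of_bounded
        (by simpa using hid.sub_const r) ⟨c⁻¹, hbdd⟩
    have h2 : Tendsto (fun t => (t * (f (u t))⁻¹) • e) (𝓝[>] r) (𝓝 0) := by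
      simpa using (hid.mul (tendsto_inv_atTop_zero.comp hlarge)).smul_const e
    have h3 := h1.sub h2
    rw [sub_zero] at h3
    refine h3.congr' ?_
    filter_upwards [self_mem_nhdsWithin] with t ht
    simp only [w, map_smul, hAu ht]
    module
  have hcl := MapClusterPt.continuousAt_comp (f := fun x => A x - r • x) (by fun_prop) hv
  exact sub_eq_zero.1 (eq_of_nhds_neBot (hcl.clusterPt.mono hlim))

theorem stmt2 {E : Type*} [NormedAddCommGroup E] [NormedSpace ℝ E]
    [FiniteDimensional ℝ E] [Nontrivial E]
    (Λ : E →L[ℝ] E) (hΛ : Function.Bijective Λ)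
    (K : Set E)
    (hconv : ∀ x ∈ K, ∀ y ∈ K, x + y ∈ K)
    (hcone : ∀ t : ℝ, 0 < t → ∀ x ∈ K, t • x ∈ K)
    (hinv : ∀ x ∈ K, Λ x ∈ K)
    (hspan : Submodule.span ℝ K = ⊤)
    (hsalient : closure K ∩ (-(closure K)) = {0})
    (lam : ℝ)
    (hlam : lam = Filter.limsup (fun n : ℕ => ‖Λ ^ n‖ ^ ((n : ℝ)⁻¹)) Filter.atTop) :
    ∃ v ∈ closure K, v ≠ 0 ∧ Λ v = lam • v := by
  have hadd : ∀ x ∈ closure K, ∀ y ∈ closure K, x + y ∈ closure K := fun x hx y hy =>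
    map_mem_closure₂ continuous_add hx hy hconv
  have hzero : (0 : E) ∈ closure K := (hsalient.ge rfl).1
  have hsmul : ∀ t : ℝ, 0 ≤ t → ∀ x ∈ closure K, t • x ∈ closure K := by
    intro t ht x hx
    rcases ht.eq_or_lt with rfl | ht
    · simpa using hzero
    · exact map_mem_closure (continuous_const_smul t) hx (hcone t ht)
  have hinv' : ∀ x ∈ closure K, Λ x ∈ closure K := fun x hx =>
    map_mem_closure Λ.continuous hx hinv
  have hsal : ∀ x ∈ closure K, -x ∈ closure K → x = 0 := fun x hx hx' =>
    hsalient.le ⟨hx, hx'⟩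
  have hspan' : Submodule.span ℝ (closure K) = ⊤ :=
    top_unique (hspan.ge.trans (Submodule.span_mono subset_closure))
  let a : (E →L[ℝ] E)ˣ := (ContinuousLinearEquiv.unitsEquiv ℝ E).symm
    (ContinuousLinearEquiv.ofBijective Λ (LinearMap.ker_eq_bot.2 hΛ.1)
      (LinearMap.range_eq_top.2 hΛ.2))
  have ha : (a : E →L[ℝ] E) = Λ := by
    ext x
    rfl
  obtain ⟨r, hr, hle, hlim⟩ := a.tendsto_norm_pow_rpow_inv
  rw [ha] at hle hlim
  rw [hlim.limsup_eq] at hlam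
  subst hlam
  refine Λ.exists_eigenvector_of_salient_cone isClosed_closure hzero hadd hsmul hsal hspan' hinv'
    hr hle fun t ht => ?_
  filter_upwards [hlim.eventually_lt_const ht, eventually_gt_atTop 0] with n hn hn0
  rw [← Real.rpow_inv_natCast_pow (norm_nonneg (Λ ^ n)) hn0.ne']
  gcongr
end
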